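/- arXiv:1912.10767 — 2 statements merged into one kernel-verified Lean document; each statement's English description precedes it below -/
import Mathlib

section
/- Let X be a nonempty compact Hausdorff totally disconnected topological space (a Stone space), and let G be a group acting on X by homeomorphisms such that for every nonempty clopen subset U ⊆ X and every point x ∈ U, the orbit of x under the rigid stabilizer G_(U) = {h ∈ G | ∀ y ∉ U, h • y = y} is infinite. Then for every pair of distinct points x ≠ y in X, the orbit of x under the stabilizer Stab_G(y) is infinite. -/
open Pointwise

/-- The rigid stabilizer of a subset `U ⊆ X` under an action of `G` on `X`: the subgroup of
elements acting trivially outside of `U`. -/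
def rigidStabilizer (G : Type*) {X : Type*} [Group G] [MulAction G X] (U : Set X) :
    Subgroup G where
  carrier := {h : G | ∀ y ∉ U, h • y = y}
  one_mem' := fun y _ => one_smul G y
  mul_mem' := by
    intro a b ha hb y hy
    rw [mul_smul, hb y hy, ha y hy]
  inv_mem' := by
    intro a ha y hy
    conv_lhs => rw [← ha y hy]
    exact inv_smul_smul a y

/-- The rigid stabilizer of `U` fixes every point outside `U`. -/
theorem rigidStabilizer_le_stabilizer {G X : Type*} [Group G] [MulAction G X] {U : Set X}
    {y : X} (hy : y ∉ U) : rigidStabilizer G U ≤ MulAction.stabilizer G y :=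
  fun _ hg => hg y hy

/-- Let `X` be a Stone space (nonempty, compact, Hausdorff, totally
disconnected) and `G` a group acting on `X` by homeomorphisms such that for every nonempty
clopen `U ⊆ X` and every `x ∈ U` the orbit of `x` under the rigid stabilizer of `U` is
infinite. Then for distinct points `x ≠ y`, the orbit of `x` under `Stab_G(y)` is infinite. -/
theorem orbit_stabilizer_infinite_of_ne {G X : Type*} [Group G] [TopologicalSpace X]
    [CompactSpace X] [T2Space X] [TotallyDisconnectedSpace X] [Nonempty X]
    [MulAction G X] (hcont : ∀ g : G, Continuous fun x : X => g • x)
    (horb : ∀ U : Set X, IsClopen U → U.Nonempty → ∀ x ∈ U,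
      (MulAction.orbit (↥(rigidStabilizer G U)) x).Infinite)
    (x y : X) (hxy : x ≠ y) :
    (MulAction.orbit (↥(MulAction.stabilizer G y)) x).Infinite := by
  obtain ⟨U, hU, hxU, hUy⟩ :=
    compact_exists_isClopen_in_isOpen (isOpen_compl_singleton (x := y)) hxy
  have hyU : y ∉ U := fun hy => hUy hy rfl
  refine (horb U hU ⟨x, hxU⟩ x hxU).mono ?_
  rintro _ ⟨g, rfl⟩
  exact ⟨⟨g, rigidStabilizer_le_stabilizer hyU g.2⟩, rfl⟩
end

section
/- Let X be a nonempty compact Hausdorff totally disconnected topological space (a Stone space), and let G be a countable group acting on X by homeomorphisms such that for every nonempty clopen subset U ⊆ X and every point x ∈ U, the orbit of x under the rigid stabilizer G_(U) = {h ∈ G | ∀ y ∉ U, h • y = y} is infinite. Let x, y ∈ X lie in distinct G-orbits, and set H = Stab_G(x), K = Stab_G(y). Then the quasi-regular unitary representations of G on ℓ²(G/H) and ℓ²(G/K) (where g acts by (g · f)(c) = f(g⁻¹ • c)) are not unitarily equivalent: there is no surjective linear isometry T : ℓ²(G/H) → ℓ²(G/K) satisfying T(g · f) = g · (T f) for all g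 ∈ G and f ∈ ℓ²(G/H). -/
open Pointwise

theorem Memℓp.comp_equiv {ι κ : Type*} {f : ι → ℂ} (hf : Memℓp f 2) (e : κ ≃ ι) :
    Memℓp (fun k => f (e k)) 2 := by
  apply memℓp_gen
  have h2 : (0:ℝ) < (2 : ENNReal).toReal := by norm_num
  have hs := (memℓp_gen_iff h2).mp hf
  exact (Equiv.summable_iff e (f := fun i => ‖f i‖ ^ (2 : ENNReal).toReal)).mpr hs

/-- The linear isometry equivalence of `ℓ²` spaces induced by a bijection of index sets. -/
noncomputable def lpCongr {ι κ : Type*} (e : ι ≃ κ) :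
    lp (fun _ : ι => ℂ) 2 ≃ₗᵢ[ℂ] lp (fun _ : κ => ℂ) 2 where
  toFun f := ⟨fun k => f (e.symm k), (lp.memℓp f).comp_equiv e.symm⟩
  invFun f := ⟨fun i => f (e i), (lp.memℓp f).comp_equiv e⟩
  left_inv f := lp.ext (funext fun i => by simp)
  right_inv f := lp.ext (funext fun k => by simp)
  map_add' f g := lp.ext (funext fun k => rfl)
  map_smul' c f := lp.ext (funext fun k => rfl)
  norm_map' f := by
    have h2 : (0:ℝ) < (2 : ENNReal).toReal := by norm_num
    rw [lp.norm_eq_tsum_rpow h2, lp.norm_eq_tsum_rpow h2]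
    congr 1
    exact e.symm.tsum_eq fun i => ‖f i‖ ^ (2 : ENNReal).toReal

/-- The quasi-regular unitary representation of `G` on `ℓ²(G/H)`: the element `g : G` acts by
the linear isometry `(g • f) (c) = f (g⁻¹ • c)` induced by left translation on `G ⧸ H`. -/
noncomputable def quasiRegular {G : Type*} [Group G] (H : Subgroup G) (g : G) :
    lp (fun _ : G ⧸ H => ℂ) 2 ≃ₗᵢ[ℂ] lp (fun _ : G ⧸ H => ℂ) 2 :=
  lpCongr (MulAction.toPerm g : Equiv.Perm (G ⧸ H))

/-- A square-summable function takes each nonzero value only finitely often. -/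
theorem lp.finite_setOf_apply_eq {ι : Type*} (f : lp (fun _ : ι => ℂ) 2) {a : ℂ} (ha : a ≠ 0) :
    {i | f i = a}.Finite := by
  have h2 : (0:ℝ) < (2 : ENNReal).toReal := by norm_num
  have hpos : (0:ℝ) < ‖a‖ ^ (2 : ENNReal).toReal :=
    Real.rpow_pos_of_pos (norm_pos_iff.mpr ha) _
  have hs := (memℓp_gen_iff h2).mp (lp.memℓp f)
  have hev := hs.tendsto_cofinite_zero.eventually_lt_const hpos
  refine (Filter.eventually_cofinite.mp hev).subset fun i hi => ?_
  have hi' : f i = a := hi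
  simp [hi']

theorem lp.eq_zero_of_infinite_fiber {ι : Type*} (f : lp (fun _ : ι => ℂ) 2) (c : ι)
    (hc : {i | f i = f c}.Infinite) : f c = 0 := by
  by_contra h
  exact hc (lp.finite_setOf_apply_eq f h)

theorem quasiRegular_single_one {G : Type*} [Group G] (H : Subgroup G) [DecidableEq (G ⧸ H)]
    {h : G} (hh : h ∈ H) :
    quasiRegular H h (lp.single (E := fun _ : G ⧸ H => ℂ) 2 ((1 : G) : G ⧸ H) 1) =
      lp.single (E := fun _ : G ⧸ H => ℂ) 2 ((1 : G) : G ⧸ H) 1 := by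
  refine lp.ext (funext fun c => ?_)
  have hfix : h • ((1 : G) : G ⧸ H) = ((1 : G) : G ⧸ H) := by
    rw [MulAction.Quotient.smul_coe, smul_eq_mul, mul_one, QuotientGroup.eq]
    simpa using hh
  change lp.single (E := fun _ : G ⧸ H => ℂ) 2 ((1 : G) : G ⧸ H) 1 (h⁻¹ • c) = _
  have hiff : h⁻¹ • c = ((1 : G) : G ⧸ H) ↔ c = ((1 : G) : G ⧸ H) := by
    rw [inv_smul_eq_iff, hfix]
  simp only [lp.coeFn_single, Pi.single_apply, hiff]

/-- A vector of `ℓ²(G / Stab_G(y))` invariant under the rigid stabilizer of a set `U` vanishes at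
every coset `g Stab_G(y)` such that the orbit of `g • y` under that rigid stabilizer is infinite. -/
theorem apply_eq_zero_of_rigidStabilizer_invariant {G X : Type*} [Group G] [MulAction G X]
    {U : Set X} {y : X} (f : lp (fun _ : G ⧸ MulAction.stabilizer G y => ℂ) 2)
    (hf : ∀ h ∈ rigidStabilizer G U, quasiRegular (MulAction.stabilizer G y) h f = f) (g : G)
    (horb : (MulAction.orbit (↥(rigidStabilizer G U)) (g • y)).Infinite) :
    f (g : G ⧸ MulAction.stabilizer G y) = 0 := by
  refine lp.eq_zero_of_infinite_fiber f _ (Set.Infinite.of_image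
    (MulAction.ofQuotientStabilizer G y) (horb.mono ?_))
  rintro _ ⟨⟨h, hh⟩, rfl⟩
  refine ⟨((h * g : G) : G ⧸ MulAction.stabilizer G y), ?_, ?_⟩
  · have hinv := congrArg (fun F : lp (fun _ : G ⧸ MulAction.stabilizer G y => ℂ) 2 =>
      F ((g : G) : G ⧸ MulAction.stabilizer G y)) (hf h⁻¹ (inv_mem hh))
    change f (h⁻¹⁻¹ • ((g : G) : G ⧸ MulAction.stabilizer G y)) = _ at hinv
    rwa [inv_inv] at hinv
  · simp [MulAction.ofQuotientStabilizer_mk, mul_smul, Subgroup.smul_def]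

/-- Let `X` be a Stone space and `G` a countable group acting on `X` by
homeomorphisms with infinite rigid-stabilizer orbits on nonempty clopen sets. If `x, y ∈ X`
lie in distinct `G`-orbits, then the quasi-regular representations of `G` on
`ℓ²(G / Stab_G(x))` and `ℓ²(G / Stab_G(y))` are not unitarily equivalent: there is no
surjective linear isometry intertwining them. -/
theorem quasiRegular_stabilizers_not_unitarily_equivalent {G X : Type*} [Group G] [Countable G]
    [TopologicalSpace X] [CompactSpace X] [T2Space X] [TotallyDisconnectedSpace X]
    [Nonempty X] [MulAction G X] (hcont : ∀ g : G, Continuous fun x : X => g • x)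
    (horb : ∀ U : Set X, IsClopen U → U.Nonempty → ∀ x ∈ U,
      (MulAction.orbit (↥(rigidStabilizer G U)) x).Infinite)
    (x y : X) (hxy : y ∉ MulAction.orbit G x) :
    ¬ ∃ T : lp (fun _ : G ⧸ MulAction.stabilizer G x => ℂ) 2 ≃ₗᵢ[ℂ]
          lp (fun _ : G ⧸ MulAction.stabilizer G y => ℂ) 2,
        ∀ (g : G) (f : lp (fun _ : G ⧸ MulAction.stabilizer G x => ℂ) 2),
          T (quasiRegular (MulAction.stabilizer G x) g f)
            = quasiRegular (MulAction.stabilizer G y) g (T f) := by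
  classical
  rintro ⟨T, hT⟩
  set δ : lp (fun _ : G ⧸ MulAction.stabilizer G x => ℂ) 2 :=
    lp.single 2 ((1 : G) : G ⧸ MulAction.stabilizer G x) (1 : ℂ) with hδ
  have hzero : T δ = 0 := by
    refine lp.ext (funext fun c => ?_)
    induction c using QuotientGroup.induction_on with
    | H g =>
      have hne : g • y ≠ x := fun h => hxy ⟨g⁻¹, by simp [← h]⟩
      obtain ⟨U, hU, hyU, hxU⟩ := exists_isClopen_of_totally_separated hne
      refine apply_eq_zero_of_rigidStabilizer_invariant (U := U) (T δ) (fun h hh => ?_) g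
        (horb U hU ⟨_, hyU⟩ _ hyU)
      have hx : h ∈ MulAction.stabilizer G x := hh x hxU
      rw [← hT, hδ, quasiRegular_single_one _ hx]
  have hδ0 : δ = 0 := T.map_eq_zero_iff.mp hzero
  have h1 : δ ((1 : G) : G ⧸ MulAction.stabilizer G x) = 1 := by simp [hδ]
  rw [hδ0] at h1
  simp at h1
end
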